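/- (Fourth-order quantum normal form computation for a one-dimensional barrier: appearance of the ħ² Moyal correction.) Let d = 1 and let λ, v₃, v₄ ∈ ℝ with λ ≠ 0, regarded as constants. In R = ℂ[ħ, q, p] set H₂ := λ·q·p, H₃ := v₃·(p³ − 3p²q + 3pq² − q³), H₄ := v₄·(p⁴ − 4p³q + 6p²q² − 4pq³ + q⁴), and W₃ := (v₃/(3λ))·(p³ − 9p²q − 9pq² + q³). Then: (i) H₃ + {W₃, H₂} = 0 (W₃ solves the third-order homological equation); and (ii) H₄ + {W₃, H₃}_M + (1/2)·{W₃, {W₃, H₂}_M}_M = v₄·(p⁴ − 4p³q + 6p²q² − 4pq³ + q⁴) − (v₃²/λ)·(3p⁴ + 12p³q − 30p²q² + 12pq³ + 3q⁴ − 4ħ²). In particular the transformed fourth-order term contains the term 4ħ²v₃²/λ, which has no classical counterpart and arises from the Moyal bracket of two cubic polynomials. -/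

import Mathlib

open MvPolynomial

/-- Variables of the polynomial ring `R = ℂ[ħ, q₁, …, q_d, p₁, …, p_d]`:
`PVar.h` is `ħ`, `PVar.q k` is `q_k` and `PVar.p k` is `p_k`. -/
inductive PVar (d : ℕ) : Type where
  | h : PVar d
  | q : Fin d → PVar d
  | p : Fin d → PVar d
  deriving DecidableEq

/-- The commutative polynomial ring `R = ℂ[ħ, q₁, …, q_d, p₁, …, p_d]`. -/
abbrev Rpoly (d : ℕ) : Type := MvPolynomial (PVar d) ℂ

/-- `ħ` as an element of `R`. -/
noncomputable def hbar (d : ℕ) : Rpoly d := X PVar.h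

/-- The formal partial derivative with respect to a variable, as a linear endomorphism. -/
noncomputable def pd {d : ℕ} (v : PVar d) : Module.End ℂ (Rpoly d) :=
  (pderiv v).toLinearMap

/-- Iterated partial derivative `∂^μ` with respect to the family of variables `f`. -/
noncomputable def pdMulti {d : ℕ} (f : Fin d → PVar d) (μ : Fin d → ℕ) :
    Module.End ℂ (Rpoly d) :=
  (List.ofFn fun k => pd (f k) ^ μ k).prod

/-- The bidifferential operator
`P^n(A,B) = Σ_{μ,ν ∈ ℕ^d, |μ|+|ν|=n} (n!/(μ!·ν!)) (−1)^{|ν|} (∂_q^μ ∂_p^ν A)·(∂_p^μ ∂_q^ν B)`.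
(Any multi-index contributing to the sum has all entries `≤ n`, so the sum below over
`μ ν : Fin d → Fin (n+1)` captures exactly the nonzero part of this sum.) -/
noncomputable def Pop {d : ℕ} (n : ℕ) (A B : Rpoly d) : Rpoly d :=
  ∑ μ : Fin d → Fin (n + 1), ∑ ν : Fin d → Fin (n + 1),
    if (∑ k, (μ k : ℕ)) + (∑ k, (ν k : ℕ)) = n then
      C (((n.factorial : ℂ) /
            (((∏ k, Nat.factorial (μ k)) * ∏ k, Nat.factorial (ν k) : ℕ) : ℂ)) *
          (-1 : ℂ) ^ (∑ k, (ν k : ℕ))) *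
        pdMulti PVar.q (fun k => (μ k : ℕ)) (pdMulti PVar.p (fun k => (ν k : ℕ)) A) *
        pdMulti PVar.p (fun k => (μ k : ℕ)) (pdMulti PVar.q (fun k => (ν k : ℕ)) B)
    else 0

/-- The Poisson bracket `{A,B} = P^1(A,B) = Σ_k (∂_{q_k}A·∂_{p_k}B − ∂_{p_k}A·∂_{q_k}B)`. -/
noncomputable def poisson {d : ℕ} (A B : Rpoly d) : Rpoly d :=
  ∑ k : Fin d, (pd (PVar.q k) A * pd (PVar.p k) B - pd (PVar.p k) A * pd (PVar.q k) B)

/-- The Moyal bracket `{A,B}_M = Σ_{k≥0} ((−1)^k (ħ/2)^{2k}/(2k+1)!) P^{2k+1}(A,B)`.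
On polynomials this series is a finite sum: all terms with `2k+1` exceeding the total
degree vanish, so the truncation below equals the full series. -/
noncomputable def moyal {d : ℕ} (A B : Rpoly d) : Rpoly d :=
  ∑ k ∈ Finset.range (A.totalDegree + B.totalDegree + 1),
    C ((-1 : ℂ) ^ k / ((2 * k + 1).factorial : ℂ)) *
      (C (1 / 2 : ℂ) * hbar d) ^ (2 * k) * Pop (2 * k + 1) A B

/-- The Moyal star product `A⋆B = Σ_{k≥0} (1/k!)(iħ/2)^k P^k(A,B)`.
On polynomials this series is a finite sum: all terms with `k` exceeding the total
degree vanish, so the truncation below equals the full series. -/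
noncomputable def starP {d : ℕ} (A B : Rpoly d) : Rpoly d :=
  ∑ k ∈ Finset.range (A.totalDegree + B.totalDegree + 1),
    C ((k.factorial : ℂ))⁻¹ * (C (Complex.I / 2) * hbar d) ^ k * Pop k A B

/-- The Moyal adjoint `Mad_W A = {W,A}_M`. -/
noncomputable def Mad {d : ℕ} (W A : Rpoly d) : Rpoly d := moyal W A

/-- The weight of a variable: `q_k, p_k` have weight 1, `ħ` has weight 2. -/
def wtv {d : ℕ} : PVar d → ℕ
  | .h => 2
  | .q _ => 1
  | .p _ => 1

/-- The weight `2j + |α| + |β|` of a monomial `ħ^j q^α p^β` with exponent data `m`. -/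
def wt {d : ℕ} (m : PVar d →₀ ℕ) : ℕ := m.sum fun v e => wtv v * e

/-- The space `𝒲^s`: the ℂ-linear span of the monomials `ħ^j q^α p^β` with
`2j+|α|+|β| = s`; it is `{0}` for `s < 0`. -/
noncomputable def Wgr (d : ℕ) (s : ℤ) : Submodule ℂ (Rpoly d) :=
  Submodule.span ℂ {P : Rpoly d | ∃ m : PVar d →₀ ℕ, (wt m : ℤ) = s ∧ P = monomial m 1}

/-- The position variable `q` (one degree of freedom). -/
noncomputable def Qv : Rpoly 1 := X (PVar.q 0)

/-- The momentum variable `p` (one degree of freedom). -/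
noncomputable def Pv : Rpoly 1 := X (PVar.p 0)

/-- The quadratic term `H₂ = λ·q·p`. -/
noncomputable def H2b (lam : ℝ) : Rpoly 1 := C (lam : ℂ) * Qv * Pv

/-- The cubic term `H₃ = v₃·(p³ − 3p²q + 3pq² − q³)`. -/
noncomputable def H3b (v3 : ℝ) : Rpoly 1 :=
  C (v3 : ℂ) * (Pv ^ 3 - 3 * Pv ^ 2 * Qv + 3 * Pv * Qv ^ 2 - Qv ^ 3)

/-- The quartic term `H₄ = v₄·(p⁴ − 4p³q + 6p²q² − 4pq³ + q⁴)`. -/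
noncomputable def H4b (v4 : ℝ) : Rpoly 1 :=
  C (v4 : ℂ) * (Pv ^ 4 - 4 * Pv ^ 3 * Qv + 6 * Pv ^ 2 * Qv ^ 2 - 4 * Pv * Qv ^ 3 + Qv ^ 4)

/-- The generator `W₃ = (v₃/(3λ))·(p³ − 9p²q − 9pq² + q³)`. -/
noncomputable def W3b (lam v3 : ℝ) : Rpoly 1 :=
  C ((v3 : ℂ) / (3 * (lam : ℂ))) * (Pv ^ 3 - 9 * Pv ^ 2 * Qv - 9 * Pv * Qv ^ 2 + Qv ^ 3)

/-- Applying `k` derivatives lowers the degree bound by `k`. -/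
theorem coeff_pd_pow_eq_zero {d : ℕ} (v : PVar d) (k : ℕ) {n : ℕ} {A : Rpoly d}
    (hA : ∀ m : PVar d →₀ ℕ, n + k ≤ m.degree → coeff m A = 0)
    (m : PVar d →₀ ℕ) (hm : n ≤ m.degree) : coeff m ((pd v ^ k) A) = 0 := by
  induction k generalizing n m with
  | zero => exact hA m hm
  | succ k ih =>
    have hm' : n + 1 ≤ (m + Finsupp.single v 1).degree := by
      rw [map_add, Finsupp.degree_single]; lia
    have h := ih (fun m hm => hA m (by lia)) _ hm'
    rw [pow_succ', Module.End.mul_apply, pd, Derivation.coeFn_coe, coeff_pderiv, ← pd, h, zero_mul]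

/-- A mixed derivative of order `|μ|` lowers the degree bound by `|μ|`. -/
theorem coeff_pdMulti_eq_zero {d : ℕ} (f : Fin d → PVar d) (μ : Fin d → ℕ) {n : ℕ} {A : Rpoly d}
    (hA : ∀ m : PVar d →₀ ℕ, n + ∑ k, μ k ≤ m.degree → coeff m A = 0)
    (m : PVar d →₀ ℕ) (hm : n ≤ m.degree) : coeff m (pdMulti f μ A) = 0 := by
  rw [← List.sum_ofFn, List.ofFn_eq_map] at hA
  rw [pdMulti, List.ofFn_eq_map]
  generalize List.finRange d = l at hA ⊢
  induction l generalizing n m with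
  | nil => exact hA m (by simpa using hm)
  | cons a l ih =>
    rw [List.map_cons, List.prod_cons, Module.End.mul_apply]
    refine coeff_pd_pow_eq_zero _ _ (fun m hm => ih m hm fun m hm => hA m ?_) m hm
    rw [List.map_cons, List.sum_cons]
    lia

/-- `P^n(A, B)` vanishes as soon as `n` exceeds the total degree of `A`. -/
theorem Pop_eq_zero_of_totalDegree_lt {d n : ℕ} {A : Rpoly d} (hA : A.totalDegree < n)
    (B : Rpoly d) : Pop n A B = 0 := by
  refine Finset.sum_eq_zero fun μ _ => Finset.sum_eq_zero fun ν _ => ?_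
  split_ifs with h
  · have hzero : pdMulti PVar.q (fun k => (μ k : ℕ)) (pdMulti PVar.p (fun k => (ν k : ℕ)) A) = 0 := by
      ext m
      rw [coeff_zero]
      refine coeff_pdMulti_eq_zero _ _ (n := 0) (coeff_pdMulti_eq_zero _ _ fun m hm => ?_) m
        (Nat.zero_le _)
      refine coeff_eq_zero_of_totalDegree_lt ?_
      rw [← Finsupp.degree_apply]
      lia
    rw [hzero, mul_zero, zero_mul]
  · rfl

theorem pdMulti_one (f : Fin 1 → PVar 1) (μ : Fin 1 → ℕ) : pdMulti f μ = pd (f 0) ^ μ 0 := by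
  simp [pdMulti]

/-- In one degree of freedom, `P^n` is a sum over pairs of indices. -/
theorem Pop_one_dim (n : ℕ) (A B : Rpoly 1) :
    Pop n A B = ∑ a : Fin (n + 1), ∑ b : Fin (n + 1), if (a : ℕ) + b = n then
      C ((n.factorial : ℂ) / ((a : ℕ).factorial * (b : ℕ).factorial : ℕ) * (-1) ^ (b : ℕ)) *
        (pd (.q 0) ^ (a : ℕ)) ((pd (.p 0) ^ (b : ℕ)) A) *
        (pd (.p 0) ^ (a : ℕ)) ((pd (.q 0) ^ (b : ℕ)) B) else 0 := by
  refine Fintype.sum_equiv (Equiv.funUnique (Fin 1) (Fin (n + 1))) _ _ fun μ => ?_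
  refine Fintype.sum_equiv (Equiv.funUnique (Fin 1) (Fin (n + 1))) _ _ fun ν => ?_
  simp [pdMulti_one]

theorem Pop_one_eq (A B : Rpoly 1) :
    Pop 1 A B = pd (.q 0) A * pd (.p 0) B - pd (.p 0) A * pd (.q 0) B := by
  simp [Pop_one_dim, Fin.sum_univ_succ]
  ring

theorem Pop_three_eq (A B : Rpoly 1) :
    Pop 3 A B =
      pd (.q 0) (pd (.q 0) (pd (.q 0) A)) * pd (.p 0) (pd (.p 0) (pd (.p 0) B)) -
      3 * pd (.q 0) (pd (.q 0) (pd (.p 0) A)) * pd (.p 0) (pd (.p 0) (pd (.q 0) B)) +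
      3 * pd (.q 0) (pd (.p 0) (pd (.p 0) A)) * pd (.p 0) (pd (.q 0) (pd (.q 0) B)) -
      pd (.p 0) (pd (.p 0) (pd (.p 0) A)) * pd (.q 0) (pd (.q 0) (pd (.q 0) B)) := by
  have h : (C (3 : ℂ) : Rpoly 1) = 3 := map_ofNat C 3
  norm_num [Pop_one_dim, Fin.sum_univ_succ, pow_succ, Nat.factorial, h]
  ring

/-- The Moyal bracket with a polynomial of degree at most three has a single quantum correction. -/
theorem moyal_of_totalDegree_le_three {A : Rpoly 1} (hA : A.totalDegree ≤ 3) (B : Rpoly 1) :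
    moyal A B = Pop 1 A B - C (1 / 24 : ℂ) * hbar 1 ^ 2 * Pop 3 A B := by
  have hvanish : ∀ k, A.totalDegree < 2 * k + 1 →
      C ((-1 : ℂ) ^ k / ((2 * k + 1).factorial : ℂ)) *
        (C (1 / 2 : ℂ) * hbar 1) ^ (2 * k) * Pop (2 * k + 1) A B = 0 := fun k hk => by
    rw [Pop_eq_zero_of_totalDegree_lt hk, mul_zero]
  have htwo : moyal A B = ∑ k ∈ Finset.range 2,
      C ((-1 : ℂ) ^ k / ((2 * k + 1).factorial : ℂ)) *
        (C (1 / 2 : ℂ) * hbar 1) ^ (2 * k) * Pop (2 * k + 1) A B := by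
    rw [moyal]
    rcases le_total 2 (A.totalDegree + B.totalDegree + 1) with h | h
    · refine (Finset.sum_subset (Finset.range_mono h) fun k _ hk => hvanish k ?_).symm
      rw [Finset.mem_range] at hk
      lia
    · refine Finset.sum_subset (Finset.range_mono h) fun k _ hk => hvanish k ?_
      rw [Finset.mem_range] at hk
      lia
  have hC : (C (-1 / 6 : ℂ) * C (1 / 2) ^ 2 : Rpoly 1) = -C (1 / 24) := by
    rw [← C_pow, ← C_mul, ← C_neg]; norm_num
  rw [htwo, Finset.sum_range_succ, Finset.sum_range_one]
  have h6 : ((2 * 1 + 1).factorial : ℂ) = 6 := by norm_num [Nat.factorial]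
  rw [h6]
  simp only [mul_zero, pow_zero, zero_add, Nat.factorial_one, Nat.cast_one, div_one, C_1, one_mul,
    mul_one, pow_one, mul_pow]
  linear_combination hbar 1 ^ 2 * Pop 3 A B * hC

theorem totalDegree_W3b_le (lam v3 : ℝ) : (W3b lam v3).totalDegree ≤ 3 := by
  refine IsHomogeneous.totalDegree_le ?_
  have hP : Pv.IsHomogeneous 1 := isHomogeneous_X _ _
  have hQ : Qv.IsHomogeneous 1 := isHomogeneous_X _ _
  have h9 : (9 : Rpoly 1).IsHomogeneous 0 := by
    rw [← map_ofNat C 9]; exact isHomogeneous_C _ _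
  have hC := isHomogeneous_C (PVar 1) ((v3 : ℂ) / (3 * (lam : ℂ)))
  have := hC.mul ((((hP.pow 3).sub ((h9.mul (hP.pow 2)).mul hQ)).sub
    ((h9.mul hP).mul (hQ.pow 2))).add (hQ.pow 3))
  exact this

theorem pd_ofNat {d : ℕ} (v : PVar d) (n : ℕ) [n.AtLeastTwo] :
    pd v (ofNat(n) : Rpoly d) = 0 :=
  Derivation.map_natCast _ n

theorem pd_mul {d : ℕ} (v : PVar d) (A B : Rpoly d) :
    pd v (A * B) = pd v A * B + A * pd v B := pderiv_mul

theorem pd_pow {d : ℕ} (v : PVar d) (A : Rpoly d) (n : ℕ) :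
    pd v (A ^ n) = n * A ^ (n - 1) * pd v A := pderiv_pow

theorem pd_C {d : ℕ} (v : PVar d) (c : ℂ) : pd v (C c) = 0 := pderiv_C

theorem pd_one {d : ℕ} (v : PVar d) : pd v (1 : Rpoly d) = 0 := pderiv_one

theorem pd_q_Qv : pd (.q 0) Qv = 1 := pderiv_X_self _

theorem pd_p_Pv : pd (.p 0) Pv = 1 := pderiv_X_self _

theorem pd_q_Pv : pd (.q 0) Pv = 0 := pderiv_X_of_ne (by simp)

theorem pd_p_Qv : pd (.p 0) Qv = 0 := pderiv_X_of_ne (by simp)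

/-- Fourth-order quantum normal form computation for a one-dimensional
barrier: appearance of the `ħ²` Moyal correction. (i) `W₃` solves the third-order
homological equation `H₃ + {W₃, H₂} = 0`; (ii) the transformed fourth-order term
`H₄ + {W₃,H₃}_M + ½{W₃,{W₃,H₂}_M}_M` equals
`v₄(p⁴−4p³q+6p²q²−4pq³+q⁴) − (v₃²/λ)(3p⁴+12p³q−30p²q²+12pq³+3q⁴−4ħ²)`;
in particular it contains the term `4ħ²v₃²/λ`, which has no classical counterpart. -/
theorem fourth_order_qnf_barrier (lam v3 v4 : ℝ) (hlam : lam ≠ 0) :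
    H3b v3 + poisson (W3b lam v3) (H2b lam) = 0 ∧
    H4b v4 + moyal (W3b lam v3) (H3b v3) +
        C (1 / 2 : ℂ) * moyal (W3b lam v3) (moyal (W3b lam v3) (H2b lam)) =
      C (v4 : ℂ) *
          (Pv ^ 4 - 4 * Pv ^ 3 * Qv + 6 * Pv ^ 2 * Qv ^ 2 - 4 * Pv * Qv ^ 3 + Qv ^ 4) -
        C ((v3 : ℂ) ^ 2 / (lam : ℂ)) *
          (3 * Pv ^ 4 + 12 * Pv ^ 3 * Qv - 30 * Pv ^ 2 * Qv ^ 2 + 12 * Pv * Qv ^ 3 +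
            3 * Qv ^ 4 - 4 * hbar 1 ^ 2) := by
  have hl : (lam : ℂ) ≠ 0 := by exact_mod_cast hlam
  set c : ℂ := (v3 : ℂ) / (3 * (lam : ℂ)) with hc
  have hv3 : (C (v3 : ℂ) : Rpoly 1) = 3 * C (lam : ℂ) * C c := by
    rw [← map_ofNat C 3, ← C_mul, ← C_mul, hc]
    congr 1
    field_simp
  have hsq : (C ((v3 : ℂ) ^ 2 / (lam : ℂ)) : Rpoly 1) = 9 * C (lam : ℂ) * C c ^ 2 := by
    rw [← map_ofNat C 9, ← C_pow, ← C_mul, ← C_mul, hc]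
    congr 1
    field_simp
    norm_num
  have hhalf : (2 : Rpoly 1) * C (1 / 2 : ℂ) = 1 := by
    rw [← map_ofNat C 2, ← C_mul]; norm_num
  have h24 : (24 : Rpoly 1) * C (1 / 24 : ℂ) = 1 := by
    rw [← map_ofNat C 24, ← C_mul]; norm_num
  have hpois : H3b v3 + Pop 1 (W3b lam v3) (H2b lam) = 0 := by
    rw [Pop_one_eq, H3b, W3b, H2b, ← hc, hv3]
    simp only [pd_C, pd_ofNat, pd_mul, pd_pow, pd_q_Qv, pd_q_Pv, pd_p_Qv, pd_p_Pv,
      map_add, map_sub, Nat.cast_ofNat, Nat.add_one_sub_one]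
    ring
  have hP3 : Pop 3 (W3b lam v3) (H2b lam) = 0 := by
    rw [Pop_three_eq, W3b, H2b]
    simp only [pd_C, pd_ofNat, pd_one, pd_mul, pd_pow, pd_q_Qv, pd_q_Pv, pd_p_Qv, pd_p_Pv,
      map_add, map_sub, map_zero, Nat.cast_ofNat, Nat.add_one_sub_one, Nat.reduceSub, Nat.cast_one]
    ring
  have hW := totalDegree_W3b_le lam v3
  have hinner : moyal (W3b lam v3) (H2b lam) = -H3b v3 := by
    rw [moyal_of_totalDegree_le_three hW, hP3]
    linear_combination hpois
  refine ⟨?_, ?_⟩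
  · rw [Pop_one_eq] at hpois
    simpa [poisson] using hpois
  have hneg : moyal (W3b lam v3) (-H3b v3) = -moyal (W3b lam v3) (H3b v3) := by
    simp only [moyal_of_totalDegree_le_three hW, Pop_one_eq, Pop_three_eq, map_neg]
    ring
  have h1 : Pop 1 (W3b lam v3) (H3b v3) = C c * C (v3 : ℂ) * (-18 * Pv ^ 4 - 72 * Pv ^ 3 * Qv +
      180 * Pv ^ 2 * Qv ^ 2 - 72 * Pv * Qv ^ 3 - 18 * Qv ^ 4) := by
    rw [Pop_one_eq, W3b, H3b, ← hc]
    simp only [pd_C, pd_ofNat, pd_mul, pd_pow, pd_q_Qv, pd_q_Pv, pd_p_Qv, pd_p_Pv,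
      map_add, map_sub, Nat.cast_ofNat, Nat.add_one_sub_one]
    ring
  have h3 : Pop 3 (W3b lam v3) (H3b v3) = C c * C (v3 : ℂ) * (-576) := by
    rw [Pop_three_eq, W3b, H3b, ← hc]
    simp only [pd_C, pd_ofNat, pd_one, pd_mul, pd_pow, pd_q_Qv, pd_q_Pv, pd_p_Qv, pd_p_Pv,
      map_add, map_sub, map_zero, Nat.cast_ofNat, Nat.add_one_sub_one, Nat.reduceSub, Nat.cast_one]
    ring
  rw [hinner, hneg, moyal_of_totalDegree_le_three hW, h1, h3, H4b, hsq, hv3]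
  linear_combination C (lam : ℂ) * C c ^ 2 *
    ((27 * (Pv ^ 4 + 4 * Pv ^ 3 * Qv - 10 * Pv ^ 2 * Qv ^ 2 + 4 * Pv * Qv ^ 3 + Qv ^ 4) -
      864 * C (1 / 24) * hbar 1 ^ 2) * hhalf + 36 * hbar 1 ^ 2 * h24)
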